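/- Let λ_c, λ_uc ≥ 0 and 0 < σ_t < σ_T, and define h(λ_c,λ_uc) = ((λ_c+σ_t²)/(λ_c+σ_T²)) · ((λ_uc+σ_T²)/(λ_uc+σ_t²)). Then h(λ_c,λ_uc) ≥ 1 if and only if λ_c ≥ λ_uc, and h(λ_c,λ_uc) = 1 if and only if λ_c = λ_uc. Consequently, in the closed-form CFG solution the component along the k-th common principal component is amplified (scaled by h^{γ/2} ≥ 1 for γ ≥ 0) exactly when λ_{c,k} ≥ λ_{uc,k} (positive CPC) and suppressed exactly when λ_{c,k} ≤ λ_{uc,k} (negative CPC). -/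

import Mathlib

/-- The deviation of the shrinkage ratio from `1` is proportional to `c - u`. -/
lemma shrinkage_ratio_sub_one {c u s S : ℝ} (hcS : c + S ≠ 0) (hus : u + s ≠ 0) :
    (c + s) / (c + S) * ((u + S) / (u + s)) - 1 = (c - u) * ((S - s) / ((c + S) * (u + s))) := by
  field_simp
  ring

/-- **Amplification/suppression factor of CFG along a common principal component.**
For `λ_c, λ_uc ≥ 0` and `0 < σ_t < σ_T`, the factor
`h = ((λ_c+σ_t²)/(λ_c+σ_T²))·((λ_uc+σ_T²)/(λ_uc+σ_t²))` satisfies `h ≥ 1 ↔ λ_c ≥ λ_uc`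
and `h = 1 ↔ λ_c = λ_uc`; consequently for guidance strength `γ ≥ 0` the scaling
`h^{γ/2}` is `≥ 1` whenever `λ_c ≥ λ_uc` (positive CPC) and `≤ 1` whenever
`λ_c ≤ λ_uc` (negative CPC). -/
theorem cfg_cpc_scaling_factor
    (lamc lamuc : ℝ) (hlamc : 0 ≤ lamc) (hlamuc : 0 ≤ lamuc)
    (σt σT : ℝ) (hσt : 0 < σt) (hσtT : σt < σT) :
    (1 ≤ ((lamc + σt ^ 2) / (lamc + σT ^ 2)) * ((lamuc + σT ^ 2) / (lamuc + σt ^ 2)) ↔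
      lamuc ≤ lamc) ∧
    (((lamc + σt ^ 2) / (lamc + σT ^ 2)) * ((lamuc + σT ^ 2) / (lamuc + σt ^ 2)) = 1 ↔
      lamc = lamuc) ∧
    (∀ γ : ℝ, 0 ≤ γ →
      (lamuc ≤ lamc →
        1 ≤ (((lamc + σt ^ 2) / (lamc + σT ^ 2)) *
          ((lamuc + σT ^ 2) / (lamuc + σt ^ 2))) ^ (γ / 2)) ∧
      (lamc ≤ lamuc →
        (((lamc + σt ^ 2) / (lamc + σT ^ 2)) *
          ((lamuc + σT ^ 2) / (lamuc + σt ^ 2))) ^ (γ / 2) ≤ 1)) := by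
  have hσT : 0 < σT := hσt.trans hσtT
  have hcT : 0 < lamc + σT ^ 2 := by positivity
  have hut : 0 < lamuc + σt ^ 2 := by positivity
  have hk : 0 < (σT ^ 2 - σt ^ 2) / ((lamc + σT ^ 2) * (lamuc + σt ^ 2)) :=
    div_pos (sub_pos.2 (pow_lt_pow_left₀ hσtT hσt.le two_ne_zero)) (mul_pos hcT hut)
  have key := shrinkage_ratio_sub_one (s := σt ^ 2) (S := σT ^ 2) hcT.ne' hut.ne'
  have h_nonneg : 0 ≤ (lamc + σt ^ 2) / (lamc + σT ^ 2) *
      ((lamuc + σT ^ 2) / (lamuc + σt ^ 2)) := by positivity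
  have h_ge : 1 ≤ (lamc + σt ^ 2) / (lamc + σT ^ 2) *
      ((lamuc + σT ^ 2) / (lamuc + σt ^ 2)) ↔ lamuc ≤ lamc := by
    rw [← sub_nonneg, key, mul_nonneg_iff_of_pos_right hk, sub_nonneg]
  refine ⟨h_ge, ?_, fun γ hγ => ⟨fun h => ?_, fun h => ?_⟩⟩
  · rw [← sub_eq_zero, key, mul_eq_zero_iff_right hk.ne', sub_eq_zero]
  · exact Real.one_le_rpow (h_ge.2 h) (by positivity)
  · refine Real.rpow_le_one h_nonneg ?_ (by positivity)
    rw [← sub_nonpos, key]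
    exact mul_nonpos_of_nonpos_of_nonneg (sub_nonpos.2 h) hk.le
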